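/- arXiv:1812.09981 — 2 statements merged into one kernel-verified Lean document; each statement's English description precedes it below -/
import Mathlib

section
/- Let N be a commutative (not necessarily associative) algebra over a field K of characteristic ≠ 2, 3 satisfying the identity x³ = 0 for all x ∈ N (where x³ = x²·x). If N satisfies the ascending chain condition on ideals, then N is finite-dimensional over K. -/
namespace MockLie

/-! ### Certified computation with noncommutative words in four letters -/

inductive Letter
  | a | b | c | d
  deriving DecidableEq

namespace Letter

def swapPairs : Letter → Letter
  | a => c | b => d | c => a | d => b

def swapFirst : Letter → Letter
  | a => b | b => a | c => c | d => d

def swapSecond : Letter → Letter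
  | a => a | b => b | c => d | d => c

def code : Letter → ℕ
  | a => 0 | b => 1 | c => 2 | d => 3

end Letter

open Letter

abbrev Word := List Letter

/-- Jordan monomials for the product `u * v + v * u`. -/
inductive JordanMonomial
  | of (l : Letter)
  | jord (s t : JordanMonomial)

instance : Coe Letter JordanMonomial := ⟨JordanMonomial.of⟩

/-- The products of words `u ++ v` with `u ∈ A` and `v ∈ B`. -/
def wordsMul (A B : List Word) : List Word :=
  A.flatMap fun u => B.map fun v => u ++ v

/-- The words in the expansion of a Jordan monomial. -/
def JordanMonomial.words : JordanMonomial → List Word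
  | of l => [[l]]
  | jord s t => wordsMul s.words t.words ++ wordsMul t.words s.words

/-- The words in the expansion of the sum of `p * q * r` over all orderings of the factors. -/
def symmWords (A B C : List Word) : List Word :=
  wordsMul (wordsMul A B) C ++ (wordsMul (wordsMul A C) B ++ (wordsMul (wordsMul B A) C ++
    (wordsMul (wordsMul B C) A ++ (wordsMul (wordsMul C A) B ++ wordsMul (wordsMul C B) A))))

/-- The multiple by `coeff` of `left * (sum of all orderings of p, q, r) * right`. -/
structure Relation where
  coeff : ℤ
  left : Word
  p : JordanMonomial
  q : JordanMonomial
  r : JordanMonomial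
  right : Word

namespace Relation

def words (R : Relation) : List Word :=
  wordsMul (wordsMul [R.left] (symmWords R.p.words R.q.words R.r.words)) [R.right]

def reverse (R : Relation) : Relation :=
  { R with left := R.right.reverse, right := R.left.reverse }

end Relation

/-- The representative of a word under the group generated by the three swaps. -/
def relabel (w : Word) : Word :=
  let w₁ := if w.head? = some c ∨ w.head? = some d then w.map swapPairs else w
  let w₂ := if w₁.head? = some b then w₁.map swapFirst else w₁
  if w₂.find? (fun l => decide (l = c ∨ l = d)) = some d then w₂.map swapSecond else w₂

def wordKey (w : Word) : ℕ := w.foldl (fun n l => 4 * n + l.code) 1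

/-- A word with a coefficient and a sorting key. -/
structure Term where
  key : ℕ
  word : Word
  coeff : ℤ

def relabelledTerm (n : ℤ) (w : Word) : Term :=
  let w' := relabel w
  ⟨wordKey w', w', n⟩

/-- Merge two lists sorted by keys, adding up the coefficients of equal words. The first argument
bounds the number of steps. -/
def merge : ℕ → List Term → List Term → List Term
  | 0, A, B => A ++ B
  | _ + 1, [], B => B
  | _ + 1, s :: A, [] => s :: A
  | n + 1, s :: A, t :: B =>
    if s.key < t.key then s :: merge n A (t :: B)
    else if s.word = t.word then { s with coeff := s.coeff + t.coeff } :: merge n A B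
    else t :: merge n (s :: A) B

def mergePairs : List (List Term) → List (List Term)
  | A :: B :: L => merge 10000 A B :: mergePairs L
  | L => L

/-- Merge a list of lists in the given number of rounds. -/
def mergeAll : ℕ → List (List Term) → List Term
  | 0, L => L.flatten
  | n + 1, L => mergeAll n (mergePairs L)

def Relation.terms (R : Relation) : List (List Term) :=
  R.words.map fun w => [relabelledTerm R.coeff w]

section Sum

variable {M : Type*} [AddCommGroup M] (F : Word → M)

def sumTerms (A : List Term) : M := (A.map fun t => t.coeff • F t.word).sum

theorem sumTerms_append (A B : List Term) :
    sumTerms F (A ++ B) = sumTerms F A + sumTerms F B := by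
  simp [sumTerms]

theorem sumTerms_cons (t : Term) (A : List Term) :
    sumTerms F (t :: A) = t.coeff • F t.word + sumTerms F A := by
  simp [sumTerms]

theorem sumTerms_merge (n : ℕ) (A B : List Term) :
    sumTerms F (merge n A B) = sumTerms F A + sumTerms F B := by
  fun_induction merge n A B with
  | case1 => exact sumTerms_append F _ _
  | case2 => simp [sumTerms]
  | case3 => simp [sumTerms]
  | case4 n s A t B h ih => rw [sumTerms_cons, ih, sumTerms_cons F s]; abel
  | case5 n s A t B h h' ih =>
    simp only [sumTerms_cons, ih, add_smul, h']; abel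
  | case6 n s A t B h h' ih => rw [sumTerms_cons, ih, sumTerms_cons F t]; abel

theorem sumTerms_mergePairs (L : List (List Term)) :
    sumTerms F (mergePairs L).flatten = sumTerms F L.flatten := by
  fun_induction mergePairs L with
  | case1 A B L ih =>
    simp only [List.flatten_cons, sumTerms_append, sumTerms_merge, ih, add_assoc]
  | case2 => rfl

theorem sumTerms_mergeAll (n : ℕ) (L : List (List Term)) :
    sumTerms F (mergeAll n L) = sumTerms F L.flatten := by
  induction n generalizing L with
  | zero => rfl
  | succ n ih => rw [mergeAll, ih, sumTerms_mergePairs]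

theorem sumTerms_eq_zero {A : List Term} (h : A.all (fun t => decide (t.coeff = 0)) = true) :
    sumTerms F A = 0 := by
  refine List.sum_eq_zero fun m hm => ?_
  obtain ⟨t, ht, rfl⟩ := List.mem_map.1 hm
  rw [of_decide_eq_true (List.all_eq_true.1 h t ht), zero_smul]

variable {F}

theorem sumTerms_relation (hF : ∀ w, F (relabel w) = F w) (R : Relation) :
    sumTerms F R.terms.flatten = R.coeff • (R.words.map F).sum := by
  rw [Relation.terms]
  induction R.words with
  | nil => simp [sumTerms]
  | cons w A ih =>
    rw [List.map_cons, List.flatten_cons, sumTerms_append, ih, List.map_cons, List.sum_cons,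
      smul_add]
    simp [sumTerms, relabelledTerm, hF]

theorem sumTerms_relations (hF : ∀ w, F (relabel w) = F w) {A : List Relation}
    (hA : ∀ R ∈ A, (R.words.map F).sum = 0) :
    sumTerms F (A.flatMap Relation.terms).flatten = 0 := by
  induction A with
  | nil => rfl
  | cons R A ih =>
    rw [List.flatMap_cons, List.flatten_append, sumTerms_append, sumTerms_relation hF,
      hA R List.mem_cons_self, smul_zero, zero_add,
      ih fun R hR => hA R (List.mem_cons_of_mem _ hR)]

end Sum

open JordanMonomial in
/-- Relations whose sum, together with their reversals, is a multiple of the word `aabbccdd`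
up to relabelling. -/
def certificate : List Relation :=
  [⟨-36, [], a, a, c, [b, b, c, d, d]⟩, ⟨12, [], a, a, c, [b, c, b, d, d]⟩,
   ⟨12, [], a, a, c, [b, d, c, b, d]⟩, ⟨36, [], a, a, c, [c, b, d, b, d]⟩,
   ⟨-60, [], a, a, c, [c, d, d, b, b]⟩, ⟨12, [], a, a, c, [d, b, b, c, d]⟩,
   ⟨-36, [], a, a, c, [d, c, b, b, d]⟩, ⟨36, [], a, a, c, [d, c, b, d, b]⟩,
   ⟨-36, [], a, a, c, [d, d, b, b, c]⟩, ⟨36, [], a, a, c, [d, d, b, c, b]⟩,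
   ⟨12, [], a, a, c, [d, d, c, b, b]⟩, ⟨24, [], a, b, c, [d, c, a, b, d]⟩,
   ⟨-24, [], a, b, c, [d, d, a, b, c]⟩, ⟨-12, [c, d], a, a, b, [d, c, b]⟩,
   ⟨-24, [c, d], a, b, c, [a, b, d]⟩, ⟨-36, [c], a, a, c, [d, b, b, d]⟩,
   ⟨-36, [c], a, a, c, [d, b, d, b]⟩, ⟨-72, [c], a, b, c, [a, d, b, d]⟩,
   ⟨72, [c], a, b, c, [d, a, b, d]⟩, ⟨24, [d, b], a, a, c, [d, c, b]⟩,
   ⟨-72, [d, b], a, b, c, [c, d, a]⟩, ⟨-24, [d, b, d], a, b, c, [c, a]⟩,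
   ⟨-48, [d, d], a, a, b, [c, b, c]⟩, ⟨84, [d, d], a, a, b, [c, c, b]⟩,
   ⟨-72, [d, d, b], a, a, c, [b, c]⟩, ⟨-24, [d, d, b], a, b, c, [c, a]⟩,
   ⟨12, [d, d, c], a, a, c, [b, b]⟩, ⟨12, [d], a, a, b, [c, b, d, c]⟩,
   ⟨-48, [d], a, a, b, [c, c, b, d]⟩, ⟨-24, [d], a, a, b, [c, c, d, b]⟩,
   ⟨-12, [d], a, a, b, [c, d, c, b]⟩, ⟨-12, [d], a, a, b, [d, c, c, b]⟩,
   ⟨36, [d], a, a, c, [b, c, d, b]⟩, ⟨-24, [d], a, a, c, [b, d, c, b]⟩,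
   ⟨-12, [d], a, a, c, [d, b, c, b]⟩, ⟨12, [d], a, a, c, [d, c, b, b]⟩,
   ⟨-24, [d], a, b, c, [a, d, c, b]⟩, ⟨14, [], a, a, jord b b, [c, c, d, d]⟩,
   ⟨-12, [], a, a, jord b c, [c, d, d, b]⟩, ⟨282, [], a, a, jord c c, [b, b, d, d]⟩,
   ⟨24, [], a, a, jord c c, [b, d, b, d]⟩, ⟨42, [], a, a, jord c c, [b, d, d, b]⟩,
   ⟨-24, [], a, a, jord c d, [b, c, d, b]⟩, ⟨-56, [], a, b, jord a b, [c, c, d, d]⟩,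
   ⟨72, [], a, c, jord b b, [d, d, c, a]⟩, ⟨18, [b, d], a, a, jord c c, [b, d]⟩,
   ⟨72, [b], a, a, jord c c, [b, d, d]⟩, ⟨72, [b], a, a, jord c c, [d, d, b]⟩,
   ⟨-24, [b], a, b, jord c d, [c, d, a]⟩, ⟨24, [c, b], a, c, jord b d, [d, a]⟩,
   ⟨-4, [c, d], a, a, jord b b, [c, d]⟩, ⟨-8, [c, d], a, b, jord a b, [c, d]⟩,
   ⟨96, [c], a, b, jord a c, [b, d, d]⟩, ⟨30, [d, b], a, a, jord c c, [b, d]⟩,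
   ⟨36, [d, b], a, b, jord c c, [a, d]⟩, ⟨-76, [d, d], a, a, jord b b, [c, c]⟩,
   ⟨-94, [d, d], a, a, jord c c, [b, b]⟩, ⟨16, [d, d], a, b, jord a b, [c, c]⟩,
   ⟨-8, [d, d], a, c, jord a c, [b, b]⟩, ⟨-24, [d], a, a, jord b b, [c, c, d]⟩,
   ⟨8, [d], a, a, jord b b, [d, c, c]⟩, ⟨24, [d], a, a, jord b c, [c, d, b]⟩,
   ⟨-6, [d], a, a, jord c c, [b, b, d]⟩, ⟨18, [d], a, a, jord c c, [d, b, b]⟩,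
   ⟨4, [d], a, b, jord a b, [d, c, c]⟩, ⟨72, [d], a, c, jord b b, [d, c, a]⟩,
   ⟨72, [], a, a, jord b (jord c c), [b, d, d]⟩, ⟨54, [], a, a, jord b (jord c c), [d, d, b]⟩,
   ⟨6, [], a, a, jord c (jord d d), [b, b, c]⟩, ⟨-24, [], a, c, jord b (jord d d), [a, b, c]⟩,
   ⟨18, [c], a, a, jord c (jord d d), [b, b]⟩, ⟨30, [d, d], a, a, jord c (jord b b), [c]⟩,
   ⟨-6, [], a, jord b b, jord c c, [a, d, d]⟩, ⟨-276, [], a, jord b b, jord c c, [d, d, a]⟩,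
   ⟨-48, [], a, jord b c, jord d d, [a, b, c]⟩, ⟨36, [], a, jord c c, jord d d, [a, b, b]⟩,
   ⟨42, [], a, jord c c, jord d d, [b, a, b]⟩, ⟨60, [b, b], a, jord c c, jord d d, [a]⟩,
   ⟨12, [b], a, jord c d, jord c d, [b, a]⟩,
   ⟨12, [], a, jord a (jord c c), jord b (jord d d), [b]⟩,
   ⟨-60, [], jord a a, jord b b, jord c c, [d, d]⟩,
   ⟨-18, [], jord a a, jord b c, jord d d, [b, c]⟩, ⟨39, [d], jord a a, jord b b, jord c c, [d]⟩,
   ⟨6, [], jord a a, jord b b, jord c (jord d d), [c]⟩,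
   ⟨-3, [], jord a a, jord b (jord c c), jord b (jord d d), []⟩,
   ⟨-24, [], jord a b, jord a (jord c c), jord b (jord d d), []⟩]

theorem certificate_sum :
    (mergeAll 14 ([relabelledTerm 1728 [a, a, b, b, c, c, d, d]] ::
      (certificate ++ certificate.map Relation.reverse).flatMap Relation.terms)).all
        (fun t => decide (t.coeff = 0)) = true := by
  decide +kernel

/-! ### Evaluation of words -/

section Eval

variable {E : Type*} [Ring E]

def evalWord (x : Letter → E) (w : Word) : E := (w.map x).prod

def evalWords (x : Letter → E) (A : List Word) : E := (A.map (evalWord x)).sum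

theorem evalWords_append (x : Letter → E) (A B : List Word) :
    evalWords x (A ++ B) = evalWords x A + evalWords x B := by
  simp [evalWords]

theorem evalWords_mul (x : Letter → E) (A B : List Word) :
    evalWords x (wordsMul A B) = evalWords x A * evalWords x B := by
  induction A with
  | nil => simp [wordsMul, evalWords]
  | cons u A ih =>
    have h : wordsMul (u :: A) B = B.map (fun v => u ++ v) ++ wordsMul A B := rfl
    have h' : evalWords x (B.map fun v => u ++ v) = evalWord x u * evalWords x B := by
      simp only [evalWords, List.map_map, ← List.sum_map_mul_left]
      simp [evalWord, Function.comp_def]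
    rw [h, evalWords_append, ih, h']
    simp [evalWords, add_mul]

variable {V : Set E} (hV : ∀ u ∈ V, ∀ v ∈ V, u * v + v * u ∈ V)
  (hsymm : ∀ u ∈ V, ∀ v ∈ V, ∀ w ∈ V,
    u * v * w + (u * w * v + (v * u * w + (v * w * u + (w * u * v + w * v * u)))) = 0)
  {x : Letter → E} (hx : ∀ l, x l ∈ V)

include hV hx in
theorem evalWords_jordanMonomial_mem (p : JordanMonomial) : evalWords x p.words ∈ V := by
  induction p with
  | of l => simpa [JordanMonomial.words, evalWords, evalWord] using hx l
  | jord s t hs ht =>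
    rw [JordanMonomial.words, evalWords_append, evalWords_mul, evalWords_mul]
    exact hV _ hs _ ht

include hV hsymm hx in
theorem evalWords_relation (R : Relation) : evalWords x R.words = 0 := by
  have h : evalWords x (symmWords R.p.words R.q.words R.r.words) = 0 := by
    simp only [symmWords, evalWords_append, evalWords_mul]
    exact hsymm _ (evalWords_jordanMonomial_mem hV hx _) _
      (evalWords_jordanMonomial_mem hV hx _) _ (evalWords_jordanMonomial_mem hV hx _)
  simp [Relation.words, evalWords_mul, h]

/-- Symmetrization of a function of words with respect to a substitution of the letters. -/
def symmetrize (s : Letter → Letter) (F : Word → E) (w : Word) : E := F w + F (w.map s)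

/-- Symmetrization of the evaluation of words with respect to the three swaps. -/
def symmEval (x : Letter → E) : Word → E :=
  symmetrize swapPairs (symmetrize swapSecond (symmetrize swapFirst (evalWord x)))

theorem symmEval_eq (x : Letter → E) (w : Word) :
    symmEval x w =
      evalWord x w + evalWord (x ∘ swapFirst) w +
        (evalWord (x ∘ swapSecond) w + evalWord (x ∘ swapFirst ∘ swapSecond) w) +
      (evalWord (x ∘ swapPairs) w + evalWord (x ∘ swapFirst ∘ swapPairs) w +
        (evalWord (x ∘ swapSecond ∘ swapPairs) w +
          evalWord (x ∘ swapFirst ∘ swapSecond ∘ swapPairs) w)) := by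
  simp only [symmEval, symmetrize, evalWord, List.map_map]

theorem symmetrize_map_self {s : Letter → Letter} (hs : ∀ l, s (s l) = l) (F : Word → E)
    (w : Word) : symmetrize s F (w.map s) = symmetrize s F w := by
  have : s ∘ s = id := funext hs
  simp [symmetrize, this, add_comm]

theorem symmEval_swapPairs (x : Letter → E) (w : Word) :
    symmEval x (w.map swapPairs) = symmEval x w :=
  symmetrize_map_self (by rintro ⟨⟩ <;> rfl) _ w

theorem symmetrize_swapSecond_swapFirst (F : Word → E) (w : Word) :
    symmetrize swapSecond (symmetrize swapFirst F) (w.map swapFirst) =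
      symmetrize swapSecond (symmetrize swapFirst F) w := by
  have hs : ∀ l, swapFirst (swapFirst l) = l := by rintro ⟨⟩ <;> rfl
  have hc : (w.map swapFirst).map swapSecond = (w.map swapSecond).map swapFirst := by
    rw [List.map_map, List.map_map]
    exact congrArg (w.map ·) (funext fun l => by cases l <;> rfl)
  rw [symmetrize, hc, symmetrize_map_self hs, symmetrize_map_self hs, ← symmetrize]

theorem symmetrize_swapSecond_swapSecond (F : Word → E) (w : Word) :
    symmetrize swapSecond F (w.map swapSecond) = symmetrize swapSecond F w :=
  symmetrize_map_self (by rintro ⟨⟩ <;> rfl) _ w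

theorem symmEval_swapFirst (x : Letter → E) (w : Word) :
    symmEval x (w.map swapFirst) = symmEval x w := by
  have hc : (w.map swapFirst).map swapPairs = (w.map swapPairs).map swapSecond := by
    rw [List.map_map, List.map_map]
    exact congrArg (w.map ·) (funext fun l => by cases l <;> rfl)
  rw [symmEval, symmetrize, hc, symmetrize_swapSecond_swapFirst,
    symmetrize_swapSecond_swapSecond, ← symmetrize]

theorem symmEval_swapSecond (x : Letter → E) (w : Word) :
    symmEval x (w.map swapSecond) = symmEval x w := by
  have hc : (w.map swapSecond).map swapPairs = (w.map swapPairs).map swapFirst := by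
    rw [List.map_map, List.map_map]
    exact congrArg (w.map ·) (funext fun l => by cases l <;> rfl)
  rw [symmEval, symmetrize, hc, symmetrize_swapSecond_swapFirst,
    symmetrize_swapSecond_swapSecond, ← symmetrize]

theorem symmEval_relabel (x : Letter → E) (w : Word) : symmEval x (relabel w) = symmEval x w := by
  unfold relabel
  extract_lets w₁ w₂
  have h₁ : symmEval x w₁ = symmEval x w := by
    dsimp only [w₁]; split_ifs
    exacts [symmEval_swapPairs x w, rfl]
  have h₂ : symmEval x w₂ = symmEval x w₁ := by
    dsimp only [w₂]; split_ifs
    exacts [symmEval_swapFirst x w₁, rfl]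
  rw [← h₁, ← h₂]
  split_ifs
  exacts [symmEval_swapSecond x w₂, rfl]

include hV hsymm hx in
theorem sum_symmEval_relation (R : Relation) : (R.words.map (symmEval x)).sum = 0 := by
  have h : ∀ s : Letter → Letter, (R.words.map (evalWord (x ∘ s))).sum = 0 := fun s =>
    evalWords_relation (x := x ∘ s) hV hsymm (fun l => hx (s l)) R
  have h₁ : (R.words.map (evalWord x)).sum = 0 := h id
  simp only [funext (symmEval_eq x), List.sum_map_add, h, h₁, add_zero]

include hV hsymm hx in
theorem symmEval_aabbccdd : (1728 : ℤ) • symmEval x [a, a, b, b, c, c, d, d] = 0 := by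
  have h := sumTerms_eq_zero (symmEval x) certificate_sum
  rwa [sumTerms_mergeAll, List.flatten_cons, sumTerms_append,
    sumTerms_relations (symmEval_relabel x) fun R _ => sum_symmEval_relation hV hsymm hx R,
    add_zero, sumTerms_cons, relabelledTerm, symmEval_relabel, sumTerms, List.map_nil,
    List.sum_nil, add_zero] at h

end Eval

end MockLie

namespace MockLie

variable {K N : Type*} [Field K] [NonUnitalNonAssocCommRing N] [Module K N]

/-! ### Identities -/

theorem jacobi (h2 : (2 : K) ≠ 0) (h3 : (3 : K) ≠ 0) (hcube : ∀ x : N, (x * x) * x = 0)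
    (x y z : N) : (x * y) * z + (y * z) * x + (z * x) * y = 0 := by
  have e : (6 : K) • ((x * y) * z + (y * z) * x + (z * x) * y) = 3 •
      (((x + y + z) * (x + y + z)) * (x + y + z) - ((x + y) * (x + y)) * (x + y)
        - ((y + z) * (y + z)) * (y + z) - ((z + x) * (z + x)) * (z + x)
        + (x * x) * x + (y * y) * y + (z * z) * z) := by
    rw [show (6 : K) = ((6 : ℕ) : K) by norm_num, Nat.cast_smul_eq_nsmul]
    simp only [mul_add, add_mul, mul_comm y x, mul_comm z x, mul_comm z y]
    abel
  simp only [hcube, sub_zero, add_zero, smul_zero] at e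
  have h6 : (6 : K) ≠ 0 := by
    rw [show (6 : K) = 2 * 3 by norm_num]; exact mul_ne_zero h2 h3
  exact (smul_eq_zero.1 e).resolve_left h6

theorem mul_mul_eq (hJ : ∀ x y z : N, (x * y) * z + (y * z) * x + (z * x) * y = 0)
    (a x y : N) : a * (x * y) = -((a * x) * y) - x * (a * y) := by
  rw [← sub_eq_zero, ← hJ a x y, mul_comm a (x * y), mul_comm x (a * y), mul_comm y a]
  abel

section Operators

variable [SMulCommClass K N N] [IsScalarTower K N N]
  (hJ : ∀ x y z : N, (x * y) * z + (y * z) * x + (z * x) * y = 0)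

local notation "L" => LinearMap.mul K N

include hJ in
theorem mul_anticomm (u v : N) : L u * L v + L v * L u = L (-(u * v)) := by
  ext t
  simp [mul_mul_eq hJ u v t]

include hJ in
theorem symm_mul_eq_zero (h2 : (2 : K) ≠ 0) (u v w : N) :
    L u * L v * L w + (L u * L w * L v + (L v * L u * L w + (L v * L w * L u +
      (L w * L u * L v + L w * L v * L u)))) = 0 := by
  refine (smul_eq_zero.1 ?_).resolve_left h2
  calc _ = ((L u * L v + L v * L u) * L w + L w * (L u * L v + L v * L u)) +
        ((L v * L w + L w * L v) * L u + L u * (L v * L w + L w * L v)) +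
        ((L w * L u + L u * L w) * L v + L v * (L w * L u + L u * L w)) := by
        rw [two_smul]; noncomm_ring
    _ = L ((u * v) * w + (v * w) * u + (w * u) * v) := by
        simp only [mul_anticomm hJ, neg_mul, neg_neg, map_add]
    _ = 0 := by rw [hJ, map_zero]

include hJ in
theorem mul_sq (a : N) : L (a * a) = -2 * (L a * L a) := by
  have := mul_anticomm (K := K) hJ a a
  rw [map_neg, ← two_mul] at this
  rw [neg_mul, this, neg_neg]

include hJ in
theorem mul_sq_mul_sq_mul_eq_zero (h2 : (2 : K) ≠ 0) (h3 : (3 : K) ≠ 0) (a b c d : N) :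
    L (((a * a) * (b * b)) * ((c * c) * (d * d))) = 0 := by
  let x : Letter → Module.End K N := fun l =>
    match l with
    | .a => L a | .b => L b | .c => L c | .d => L d
  have h := symmEval_aabbccdd (V := Set.range (L)) (x := x)
    (by rintro _ ⟨u, rfl⟩ _ ⟨v, rfl⟩; exact ⟨_, (mul_anticomm hJ u v).symm⟩)
    (by rintro _ ⟨u, rfl⟩ _ ⟨v, rfl⟩ _ ⟨w, rfl⟩; exact symm_mul_eq_zero hJ h2 u v w)
    (by rintro ⟨⟩ <;> exact ⟨_, rfl⟩)
  have h1728 : ((1728 : ℤ) : K) ≠ 0 := by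
    rw [show ((1728 : ℤ) : K) = 2 ^ 6 * 3 ^ 3 by norm_num]
    exact mul_ne_zero (pow_ne_zero _ h2) (pow_ne_zero _ h3)
  rw [← Int.cast_smul_eq_zsmul K] at h
  replace h := (smul_eq_zero.1 h).resolve_left h1728
  have hmul (u v : N) : L (u * v) = -(L u * L v + L v * L u) := by
    rw [mul_anticomm hJ, map_neg, neg_neg]
  rw [hmul, hmul (a * a), hmul (c * c), mul_sq hJ, mul_sq hJ, mul_sq hJ, mul_sq hJ]
  refine Eq.trans (b := (-16 : ℤ) • symmEval x [.a, .a, .b, .b, .c, .c, .d, .d]) ?_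
    (by rw [h, smul_zero])
  simp only [symmEval_eq, evalWord, List.map_cons, List.map_nil, List.prod_cons, List.prod_nil,
    Function.comp_apply, Letter.swapFirst, Letter.swapSecond, Letter.swapPairs, x]
  noncomm_ring

end Operators

/-! ### Ideals -/

/-- A subspace closed under multiplication by arbitrary elements. -/
def IsIdeal (I : Submodule K N) : Prop := ∀ a : N, ∀ x ∈ I, a * x ∈ I

/-- A subspace of finite codimension. -/
def IsCofinite (I : Submodule K N) : Prop := ∃ T : Set N, T.Finite ∧ Submodule.span K T ⊔ I = ⊤

/-- The span of the products of two elements of a subspace. -/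
def square (I : Submodule K N) : Submodule K N :=
  Submodule.span K {z | ∃ x ∈ I, ∃ y ∈ I, x * y = z}

theorem IsIdeal.sup {I J : Submodule K N} (hI : IsIdeal I) (hJ : IsIdeal J) :
    IsIdeal (I ⊔ J) := by
  intro a x hx
  obtain ⟨y, hy, z, hz, rfl⟩ := Submodule.mem_sup.1 hx
  rw [mul_add]
  exact Submodule.add_mem_sup (hI a y hy) (hJ a z hz)

theorem square_top_le (h2 : (2 : K) ≠ 0) :
    square (⊤ : Submodule K N) ≤ Submodule.span K (Set.range fun a : N => a * a) := by
  refine Submodule.span_le.2 ?_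
  rintro _ ⟨x, -, y, -, rfl⟩
  have h : x * y = (2 : K)⁻¹ • ((x + y) * (x + y) - x * x - y * y) := by
    rw [eq_inv_smul_iff₀ h2, two_smul, mul_add, add_mul, add_mul, mul_comm y x]
    abel
  rw [h]
  have hs (a : N) : a * a ∈ Submodule.span K (Set.range fun a : N => a * a) :=
    Submodule.subset_span ⟨a, rfl⟩
  exact Submodule.smul_mem _ _ (sub_mem (sub_mem (hs _) (hs _)) (hs _))

/-- The product `v₁ * (v₂ * ⋯ (vₙ * s))`. -/
def iteratedMul (l : List N) (s : N) : N := l.foldr (· * ·) s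

/-- The span of `I` and the products `v₁ * (v₂ * ⋯ (vₙ * s))` with `n ≤ m` and all `vᵢ` in `T`. -/
def wordFiltration (I : Submodule K N) (T : Set N) (s : N) (m : ℕ) : Submodule K N :=
  I ⊔ Submodule.span K {z | ∃ l : List N, l.length ≤ m ∧ (∀ v ∈ l, v ∈ T) ∧ iteratedMul l s = z}

section WordFiltration

variable {I J : Submodule K N} {T : Set N} {s : N}

theorem wordFiltration_mono {m n : ℕ} (h : m ≤ n) :
    wordFiltration I T s m ≤ wordFiltration I T s n :=
  by
  refine sup_le_sup_left (Submodule.span_mono ?_) _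
  rintro _ ⟨l, hl, h'⟩
  exact ⟨l, hl.trans h, h'⟩

theorem iteratedMul_mem_wordFiltration {l : List N} (hl : ∀ v ∈ l, v ∈ T) :
    iteratedMul l s ∈ wordFiltration I T s l.length :=
  Submodule.mem_sup_right (Submodule.subset_span ⟨l, le_rfl, hl, rfl⟩)

theorem iteratedMul_mem (hJ : IsIdeal J) (hs : s ∈ J) (l : List N) : iteratedMul l s ∈ J := by
  induction l with
  | nil => exact hs
  | cons v l ih => exact hJ v _ ih

theorem wordFiltration_le (hJ : IsIdeal J) (hIJ : I ≤ J) (hs : s ∈ J) (m : ℕ) :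
    wordFiltration I T s m ≤ J := by
  refine sup_le hIJ (Submodule.span_le.2 ?_)
  rintro _ ⟨l, -, -, rfl⟩
  exact iteratedMul_mem hJ hs l

end WordFiltration

section Ideals

variable [SMulCommClass K N N] [IsScalarTower K N N]
  (hJ : ∀ x y z : N, (x * y) * z + (y * z) * x + (z * x) * y = 0)

include hJ in
theorem IsIdeal.square {I : Submodule K N} (hI : IsIdeal I) : IsIdeal (square I) := by
  intro a z hz
  refine (Submodule.span_le (p := (MockLie.square I).comap (LinearMap.mul K N a))).2 ?_ hz
  rintro _ ⟨x, hx, y, hy, rfl⟩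
  change a * (x * y) ∈ MockLie.square I
  rw [mul_mul_eq hJ]
  exact sub_mem (neg_mem (Submodule.subset_span ⟨_, hI a x hx, y, hy, rfl⟩))
    (Submodule.subset_span ⟨x, hx, _, hI a y hy, rfl⟩)

theorem square_span_le {S : Set N} {J : Submodule K N} (h : ∀ x ∈ S, ∀ y ∈ S, x * y ∈ J) :
    square (Submodule.span K S) ≤ J := by
  refine Submodule.span_le.2 ?_
  rintro _ ⟨x, hx, y, hy, rfl⟩
  induction hx, hy using Submodule.span_induction₂ with
  | mem_mem x y hx hy => exact h x hx y hy
  | zero_left y hy => simp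
  | zero_right x hx => simp
  | add_left x y z _ _ _ h₁ h₂ => rw [add_mul]; exact add_mem h₁ h₂
  | add_right x y z _ _ _ h₁ h₂ => rw [mul_add]; exact add_mem h₁ h₂
  | smul_left r x y _ _ h => rw [smul_mul_assoc]; exact J.smul_mem r h
  | smul_right r x y _ _ h => rw [mul_smul_comm]; exact J.smul_mem r h

include hJ in
/-- The third derived ideal annihilates the algebra. -/
theorem mul_eq_zero_of_mem_square (h2 : (2 : K) ≠ 0) (h3 : (3 : K) ≠ 0) {x : N}
    (hx : x ∈ square (square (square (⊤ : Submodule K N)))) (y : N) : x * y = 0 := by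
  have mono {I J : Submodule K N} (h : I ≤ J) : square I ≤ square J :=
    Submodule.span_mono fun _ ⟨x, hx, y, hy, e⟩ => ⟨x, h hx, y, h hy, e⟩
  have h₁ : square (square (⊤ : Submodule K N)) ≤
      Submodule.span K {z | ∃ a b : N, (a * a) * (b * b) = z} := by
    refine (mono (square_top_le h2)).trans (square_span_le ?_)
    rintro _ ⟨a, rfl⟩ _ ⟨b, rfl⟩
    exact Submodule.subset_span ⟨a, b, rfl⟩
  have h₂ : square (square (square (⊤ : Submodule K N))) ≤ LinearMap.ker (LinearMap.mul K N) := by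
    refine (mono h₁).trans (square_span_le ?_)
    rintro _ ⟨a, b, rfl⟩ _ ⟨c, d, rfl⟩
    exact mul_sq_mul_sq_mul_eq_zero hJ h2 h3 a b c d
  exact LinearMap.congr_fun (LinearMap.mem_ker.1 (h₂ hx)) y

/-! ### Abelian ideals of finite codimension -/

variable {I J : Submodule K N} {T : Set N} {s : N}

variable (hI : IsIdeal I) (hJi : IsIdeal J) (hIJ : I ≤ J) (hsq : square J ≤ I)
  (hT : Submodule.span K T ⊔ J = ⊤) (hs : s ∈ J)

include hI hJi hIJ hsq hT hs in
theorem mul_mem_wordFiltration {m : ℕ} (a : N) {x : N} (hx : x ∈ wordFiltration I T s m) :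
    a * x ∈ wordFiltration I T s (m + 1) := by
  have hxJ := wordFiltration_le hJi hIJ hs m hx
  have ha : a ∈ Submodule.span K T ⊔ J := hT ▸ Submodule.mem_top
  obtain ⟨t, ht, j, hj, rfl⟩ := Submodule.mem_sup.1 ha
  rw [add_mul]
  refine add_mem ?_ (Submodule.mem_sup_left (hsq (Submodule.subset_span ⟨j, hj, x, hxJ, rfl⟩)))
  obtain ⟨i, hi, y, hy, rfl⟩ := Submodule.mem_sup.1 hx
  rw [mul_add]
  refine add_mem (Submodule.mem_sup_left (hI t i hi)) (Submodule.mem_sup_right ?_)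
  clear hx hxJ ha
  induction ht, hy using Submodule.span_induction₂ with
  | mem_mem v y hv hy =>
    obtain ⟨l, hl, hlT, rfl⟩ := hy
    exact Submodule.subset_span
      ⟨v :: l, Nat.succ_le_succ hl, List.forall_mem_cons.2 ⟨hv, hlT⟩, rfl⟩
  | zero_left y hy => simp
  | zero_right x hx => simp
  | add_left x y z _ _ _ h₁ h₂ => rw [add_mul]; exact add_mem h₁ h₂
  | add_right x y z _ _ _ h₁ h₂ => rw [mul_add]; exact add_mem h₁ h₂
  | smul_left r x y _ _ h => rw [smul_mul_assoc]; exact Submodule.smul_mem _ r h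
  | smul_right r x y _ _ h => rw [mul_smul_comm]; exact Submodule.smul_mem _ r h

include hJ hI hJi hIJ hsq hT hs in
theorem mul_iteratedMul_mem_of_mem (h2 : (2 : K) ≠ 0) {l : List N} (hl : ∀ v ∈ l, v ∈ T) {u : N}
    (hu : u ∈ l) : u * iteratedMul l s ∈ wordFiltration I T s l.length := by
  induction l with
  | nil => cases hu
  | cons v l ih =>
    obtain ⟨hv, hl⟩ := List.forall_mem_cons.1 hl
    have hlow (w : N) : w * iteratedMul l s ∈ wordFiltration I T s (l.length + 1) :=
      mul_mem_wordFiltration hI hJi hIJ hsq hT hs w (iteratedMul_mem_wordFiltration hl)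
    have key : u * iteratedMul (v :: l) s =
      -((u * v) * iteratedMul l s) - v * (u * iteratedMul l s) := mul_mul_eq hJ u v _
    rcases List.mem_cons.1 hu with rfl | hu
    · have : (2 : K) • (u * iteratedMul (u :: l) s) = -((u * u) * iteratedMul l s) := by
        rw [two_smul]
        nth_rewrite 1 [key]
        exact sub_add_cancel _ _
      rw [← inv_smul_smul₀ h2 (u * iteratedMul (u :: l) s), this]
      exact Submodule.smul_mem _ _ (neg_mem (hlow _))
    · rw [key]
      exact sub_mem (neg_mem (hlow _))
        (mul_mem_wordFiltration hI hJi hIJ hsq hT hs v (ih hl hu))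

include hJ hI hJi hIJ hsq hT hs in
theorem iteratedMul_mem_of_not_nodup (h2 : (2 : K) ≠ 0) {l : List N} (hl : ∀ v ∈ l, v ∈ T)
    (hd : ¬ l.Nodup) : iteratedMul l s ∈ wordFiltration I T s (l.length - 1) := by
  induction l with
  | nil => exact absurd List.nodup_nil hd
  | cons v l ih =>
    have hl' := (List.forall_mem_cons.1 hl).2
    by_cases hv : v ∈ l
    · exact mul_iteratedMul_mem_of_mem hJ hI hJi hIJ hsq hT hs h2 hl' hv
    · have hd' : ¬ l.Nodup := fun h => hd (List.nodup_cons.2 ⟨hv, h⟩)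
      have hpos : l ≠ [] := by rintro rfl; exact hd' List.nodup_nil
      have := mul_mem_wordFiltration hI hJi hIJ hsq hT hs v (ih hl' hd')
      rwa [Nat.sub_add_cancel (List.length_pos_of_ne_nil hpos)] at this

include hJ hI hJi hIJ hsq hT hs in
theorem isIdeal_wordFiltration (h2 : (2 : K) ≠ 0) (hfin : T.Finite) :
    IsIdeal (wordFiltration I T s T.ncard) := by
  intro a x hx
  suffices wordFiltration I T s (T.ncard + 1) ≤ wordFiltration I T s T.ncard from
    this (mul_mem_wordFiltration hI hJi hIJ hsq hT hs a hx)
  refine sup_le le_sup_left (Submodule.span_le.2 ?_)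
  rintro _ ⟨l, hlen, hl, rfl⟩
  by_cases hd : l.Nodup
  · refine wordFiltration_mono ?_ (iteratedMul_mem_wordFiltration hl)
    classical
    rw [← List.toFinset_card_of_nodup hd, ← Set.ncard_coe_finset]
    exact Set.ncard_le_ncard (fun v hv => hl v (by simpa using hv)) hfin
  · exact wordFiltration_mono (by omega)
      (iteratedMul_mem_of_not_nodup hJ hI hJi hIJ hsq hT hs h2 hl hd)

include hJ hI hJi hIJ hsq in
/-- If `J` is an ideal of finite codimension and `J / I` is generated by finitely many elements and
has zero multiplication, then `I` has finite codimension. -/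
theorem isCofinite_of_square_le [WellFoundedGT {I : Submodule K N // IsIdeal I}]
    (h2 : (2 : K) ≠ 0) (hcof : IsCofinite J) : IsCofinite I := by
  obtain ⟨T, hTfin, hT⟩ := hcof
  let P : Set {W : Submodule K N // IsIdeal W} :=
    {W | W.1 ≤ J ∧ ∃ F : Set N, F.Finite ∧ W.1 = I ⊔ Submodule.span K F}
  have hne : P.Nonempty := ⟨⟨I, hI⟩, hIJ, ∅, Set.finite_empty, by simp⟩
  obtain ⟨⟨W, hW⟩, ⟨hWJ, F, hF, rfl⟩, hmax⟩ := WellFounded.has_min (wellFounded_gt) P hne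
  have hJW : J ≤ I ⊔ Submodule.span K F := by
    intro s hs
    by_contra hsW
    have hsq' := hsq.trans (le_sup_left (b := Submodule.span K F))
    have hlists : {l : List N | l.length ≤ T.ncard ∧ ∀ v ∈ l, v ∈ T}.Finite := by
      have := hTfin.to_subtype
      refine ((List.finite_length_le T T.ncard).image (List.map Subtype.val)).subset ?_
      rintro l ⟨hlen, hl⟩
      lift l to List T using hl
      exact ⟨l, by simpa using hlen, rfl⟩
    refine hmax ⟨_, isIdeal_wordFiltration hJ hW hJi hWJ hsq' hT hs h2 hTfin⟩
      ⟨wordFiltration_le hJi hWJ hs _, F ∪ (iteratedMul · s) '' _, hF.union (hlists.image _), ?_⟩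
      (lt_of_le_of_ne (Subtype.mk_le_mk.2 le_sup_left) fun h => hsW ?_)
    · change (I ⊔ Submodule.span K F) ⊔ Submodule.span K _ = _
      rw [Submodule.span_union, ← sup_assoc]
      congr 2
      ext z
      simp [and_assoc]
    · rw [Subtype.mk.injEq] at h
      rw [h]
      exact wordFiltration_mono (Nat.zero_le _) (iteratedMul_mem_wordFiltration (l := []) (by simp))
  refine ⟨T ∪ F, hTfin.union hF, eq_top_iff.2 (hT.ge.trans (sup_le ?_ (hJW.trans (sup_le ?_ ?_))))⟩
  · exact (Submodule.span_mono Set.subset_union_left).trans le_sup_left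
  · exact le_sup_right
  · exact (Submodule.span_mono Set.subset_union_right).trans le_sup_left

end Ideals

end MockLie

open MockLie

/-- Let `N` be a commutative (not necessarily associative) algebra over a field
`K` of characteristic `≠ 2, 3` satisfying the identity `x³ = 0` (where `x³ = x²·x`).  If `N`
satisfies the ascending chain condition on ideals, then `N` is finite-dimensional over `K`. -/
theorem cube_zero_noetherian_finiteDimensional {K N : Type*} [Field K]
    [NonUnitalNonAssocCommRing N] [Module K N] [SMulCommClass K N N] [IsScalarTower K N N]
    (h2 : (2 : K) ≠ 0) (h3 : (3 : K) ≠ 0)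
    (hcube : ∀ x : N, (x * x) * x = 0)
    -- a.c.c. on ideals of `N`
    (hacc : ∀ f : ℕ → Submodule K N, (∀ k, ∀ a : N, ∀ x ∈ f k, a * x ∈ f k) → Monotone f →
      ∃ n, ∀ m, n ≤ m → f m = f n) :
    FiniteDimensional K N := by
  have hJ := jacobi (K := K) h2 h3 hcube
  have : WellFoundedGT {I : Submodule K N // IsIdeal I} := by
    rw [wellFoundedGT_iff_monotone_chain_condition]
    intro f
    obtain ⟨n, hn⟩ := hacc (fun k => (f k).1) (fun k => (f k).2) fun _ _ h => f.monotone h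
    exact ⟨n, fun m hm => Subtype.ext (hn m hm).symm⟩
  suffices h : IsCofinite (⊥ : Submodule K N) by
    obtain ⟨T, hT, h⟩ := h
    exact ⟨Submodule.fg_def.2 ⟨T, hT, by rwa [sup_bot_eq] at h⟩⟩
  by_contra hbot
  obtain ⟨⟨I, hI⟩, hIcof, hmax⟩ := WellFounded.has_min (wellFounded_gt)
    {I : {I : Submodule K N // IsIdeal I} | ¬ IsCofinite I.1}
    ⟨⟨⊥, fun a x hx => by rw [(Submodule.mem_bot K).1 hx, mul_zero]; exact zero_mem _⟩, hbot⟩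
  have hle {E : Submodule K N} (hE : IsIdeal E) (hsq : square E ≤ I) : E ≤ I := by
    by_contra hEI
    have hEI' : IsCofinite (E ⊔ I) := by
      by_contra h
      exact hmax ⟨E ⊔ I, hE.sup hI⟩ h (lt_of_le_of_ne (Subtype.mk_le_mk.2 le_sup_right)
        fun h => hEI (le_sup_left.trans (Subtype.mk.inj h).ge))
    refine hIcof (isCofinite_of_square_le hJ hI (hE.sup hI) le_sup_right ?_ h2 hEI')
    refine Submodule.span_le.2 ?_
    rintro _ ⟨x, hx, y, hy, rfl⟩
    obtain ⟨e, he, i, hi, rfl⟩ := Submodule.mem_sup.1 hx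
    obtain ⟨e', he', i', hi', rfl⟩ := Submodule.mem_sup.1 hy
    have h₁ : e * e' ∈ I := hsq (Submodule.subset_span ⟨e, he, e', he', rfl⟩)
    rw [mul_add, add_mul, mul_comm i e']
    exact add_mem (add_mem h₁ (hI e' i hi)) (hI _ i' hi')
  have htop : IsIdeal (⊤ : Submodule K N) := fun _ _ _ => Submodule.mem_top
  have h₃ : square (square (square (⊤ : Submodule K N))) ≤ I := by
    refine hle ((htop.square hJ).square hJ |>.square hJ) (Submodule.span_le.2 ?_)
    rintro _ ⟨x, hx, y, -, rfl⟩
    rw [mul_eq_zero_of_mem_square hJ h2 h3 hx]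
    exact zero_mem I
  have h₀ := hle htop (hle (htop.square hJ) (hle ((htop.square hJ).square hJ) h₃))
  exact hIcof ⟨∅, Set.finite_empty, eq_top_iff.2 (h₀.trans le_sup_right)⟩
end

section
/- Let A be a Bernstein algebra over a field K of characteristic ≠ 2, 3 whose barideal N = ker(ω) is locally nilpotent. If A is Noetherian (satisfies the ascending chain condition on ideals), then A is finite-dimensional over K. -/
/-- The product of two subspaces of a (possibly non-associative, non-unital) algebra:
the linear span of all products `x * y` with `x ∈ M`, `y ∈ N`. -/
def subMul {K A : Type*} [Field K] [NonUnitalNonAssocRing A] [Module K A]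
    [SMulCommClass K A A] [IsScalarTower K A A]
    (M N : Submodule K A) : Submodule K A :=
  Submodule.map₂ (LinearMap.mul K A) M N

/-- The powers `Sⁱ` of a subspace `S`, defined (for `i ≥ 1`) by `S¹ = S` and
`Sⁱ = Σ_{r+s=i, r,s ≥ 1} Sʳ Sˢ`.  (We set `S⁰ = S`, an irrelevant junk value.) -/
def algPow {K A : Type*} [Field K] [NonUnitalNonAssocRing A] [Module K A]
    [SMulCommClass K A A] [IsScalarTower K A A]
    (S : Submodule K A) : ℕ → Submodule K A
  | 0 => S
  | 1 => S
  | n + 2 => ⨆ r : Fin (n + 1), subMul (algPow S (r + 1)) (algPow S (n + 1 - r))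
  decreasing_by
  · omega
  · omega

section Powers

variable {K A : Type*} [Field K] [NonUnitalNonAssocRing A] [Module K A]
  [SMulCommClass K A A] [IsScalarTower K A A]

theorem mul_mem_subMul {M N : Submodule K A} {x y : A} (hx : x ∈ M) (hy : y ∈ N) :
    x * y ∈ subMul M N :=
  Submodule.apply_mem_map₂ (LinearMap.mul K A) hx hy

theorem subMul_le {M N P : Submodule K A} :
    subMul M N ≤ P ↔ ∀ x ∈ M, ∀ y ∈ N, x * y ∈ P := by
  simp [subMul, Submodule.map₂_le]

theorem subMul_mono {M M' N N' : Submodule K A} (hM : M ≤ M') (hN : N ≤ N') :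
    subMul M N ≤ subMul M' N' :=
  Submodule.map₂_le_map₂ hM hN

theorem algPow_one (S : Submodule K A) : algPow S 1 = S := by
  rw [algPow]

theorem algPow_add_two_le {S P : Submodule K A} {n : ℕ}
    (h : ∀ r s, 1 ≤ r → 1 ≤ s → r + s = n + 2 → subMul (algPow S r) (algPow S s) ≤ P) :
    algPow S (n + 2) ≤ P := by
  rw [algPow]
  refine iSup_le fun r => h _ _ ?_ ?_ ?_ <;> omega

theorem subMul_algPow_le (S : Submodule K A) {r s : ℕ} (hr : 1 ≤ r) (hs : 1 ≤ s) :
    subMul (algPow S r) (algPow S s) ≤ algPow S (r + s) := by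
  obtain ⟨r, rfl⟩ := Nat.exists_eq_add_of_le' hr
  obtain ⟨s, rfl⟩ := Nat.exists_eq_add_of_le' hs
  have h := le_iSup (fun i : Fin (r + s + 1) =>
    subMul (algPow S (i + 1)) (algPow S (r + s + 1 - i))) ⟨r, by omega⟩
  have e1 : r + s + 1 - r = s + 1 := by omega
  have e2 : r + 1 + (s + 1) = r + s + 2 := by omega
  rw [e2, algPow]
  simpa only [e1] using h

theorem mul_mem_algPow {S : Submodule K A} {r s : ℕ} (hr : 1 ≤ r) (hs : 1 ≤ s) {x y : A}
    (hx : x ∈ algPow S r) (hy : y ∈ algPow S s) : x * y ∈ algPow S (r + s) :=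
  subMul_algPow_le S hr hs (mul_mem_subMul hx hy)

theorem algPow_mono {S T : Submodule K A} (h : S ≤ T) {n : ℕ} (hn : 1 ≤ n) :
    algPow S n ≤ algPow T n := by
  induction n using Nat.strong_induction_on with
  | _ n ih =>
    match n, hn with
    | 1, _ => simpa only [algPow_one] using h
    | n + 2, _ =>
      refine algPow_add_two_le fun r s hr hs hrs => ?_
      rw [← hrs]
      exact (subMul_mono (ih r (by omega) hr) (ih s (by omega) hs)).trans
        (subMul_algPow_le T hr hs)

theorem algPow_succ_le {S : Submodule K A} (hS : ∀ x ∈ S, ∀ y ∈ S, x * y ∈ S) {n : ℕ}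
    (hn : 1 ≤ n) : algPow S (n + 1) ≤ algPow S n := by
  induction n using Nat.strong_induction_on with
  | _ n ih =>
    obtain ⟨n, rfl⟩ := Nat.exists_eq_add_of_le' hn
    refine algPow_add_two_le fun r s hr hs hrs => ?_
    obtain rfl | hr2 : r = 1 ∨ 2 ≤ r := by omega
    · obtain rfl | hs2 : s = 1 ∨ 2 ≤ s := by omega
      · obtain rfl : n = 0 := by omega
        simpa only [algPow_one, zero_add] using subMul_le.2 hS
      · obtain ⟨s, rfl⟩ := Nat.exists_eq_add_of_le' hs2
        have h := ih (s + 1) (by omega) (by omega)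
        have e : n + 1 = 1 + (s + 1) := by omega
        rw [e]
        exact (subMul_mono le_rfl h).trans (subMul_algPow_le S le_rfl (by omega))
    · obtain ⟨r, rfl⟩ := Nat.exists_eq_add_of_le' hr2
      have h := ih (r + 1) (by omega) (by omega)
      have e : n + 1 = r + 1 + s := by omega
      rw [e]
      exact (subMul_mono h le_rfl).trans (subMul_algPow_le S (by omega) hs)

theorem algPow_antitone {S : Submodule K A} (hS : ∀ x ∈ S, ∀ y ∈ S, x * y ∈ S) {m n : ℕ}
    (hm : 1 ≤ m) (hmn : m ≤ n) : algPow S n ≤ algPow S m := by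
  induction n, hmn using Nat.le_induction with
  | base => exact le_rfl
  | succ n hmn ih => exact (algPow_succ_le hS (hm.trans hmn)).trans ih

theorem algPow_le_algPow_sup {N W : Submodule K A} (hWN : W ≤ N)
    (h : N ≤ W ⊔ algPow N 2) {n : ℕ} (hn : 1 ≤ n) :
    algPow N n ≤ algPow W n ⊔ algPow N (n + 1) := by
  induction n using Nat.strong_induction_on with
  | _ n ih =>
    match n, hn with
    | 1, _ => simpa only [algPow_one] using h
    | n + 2, _ =>
      refine algPow_add_two_le fun r s hr hs hrs => subMul_le.2 fun x hx y hy => ?_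
      obtain ⟨x₁, hx₁, x₂, hx₂, rfl⟩ := Submodule.mem_sup.1 (ih r (by omega) hr hx)
      obtain ⟨y₁, hy₁, y₂, hy₂, rfl⟩ := Submodule.mem_sup.1 (ih s (by omega) hs hy)
      have a := mul_mem_algPow hr hs hx₁ hy₁
      have b := mul_mem_algPow (by omega) hs hx₂ hy
      have c := mul_mem_algPow hr (by omega) (algPow_mono hWN hr hx₁) hy₂
      rw [hrs] at a
      rw [show r + 1 + s = n + 2 + 1 by omega] at b
      rw [show r + (s + 1) = n + 2 + 1 by omega] at c
      refine Submodule.mem_sup.2 ⟨_, a, _, add_mem b c, ?_⟩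
      simp only [mul_add, add_mul]
      abel

theorem finiteDimensional_algPow (S : Submodule K A) [FiniteDimensional K S] {n : ℕ}
    (hn : 1 ≤ n) : FiniteDimensional K (algPow S n) := by
  induction n using Nat.strong_induction_on with
  | _ n ih =>
    match n, hn with
    | 1, _ => rw [algPow_one]; infer_instance
    | n + 2, _ =>
      rw [algPow]
      have h (r : Fin (n + 1)) : FiniteDimensional K
          (subMul (algPow S (r + 1)) (algPow S (n + 1 - r)) : Submodule K A) :=
        Module.Finite.iff_fg.2 (Submodule.FG.map₂ _
          (Module.Finite.iff_fg.1 (ih _ (by omega) (by omega)))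
          (Module.Finite.iff_fg.1 (ih _ (by omega) (by omega))))
      infer_instance

theorem finiteDimensional_of_le_sup_algPow {N W : Submodule K A} [FiniteDimensional K W]
    (hWN : W ≤ N) (h : N ≤ W ⊔ algPow N 2) {n : ℕ} (hn : 1 ≤ n) (h0 : algPow N n = ⊥) :
    FiniteDimensional K N := by
  have key : ∀ m, 1 ≤ m → ∃ F : Submodule K A, FiniteDimensional K F ∧ N ≤ F ⊔ algPow N m := by
    intro m hm
    induction m, hm using Nat.le_induction with
    | base => exact ⟨⊥, inferInstance, by rw [algPow_one]; exact le_sup_right⟩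
    | succ m hm ih =>
      obtain ⟨F, hF, hNF⟩ := ih
      have := finiteDimensional_algPow W hm
      refine ⟨F ⊔ algPow W m, inferInstance, hNF.trans ?_⟩
      rw [sup_assoc]
      exact sup_le_sup_left (algPow_le_algPow_sup hWN h hm) F
  obtain ⟨F, hF, hNF⟩ := key n hn
  rw [h0, sup_bot_eq] at hNF
  exact Submodule.finiteDimensional_of_le hNF

end Powers

section Ideals

variable {K A : Type*} [Field K] [NonUnitalNonAssocCommRing A] [Module K A]

/-- The subspace `I` is an ideal of the commutative algebra `A`. -/
def IsAlgIdeal (I : Submodule K A) : Prop :=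
  ∀ a : A, ∀ x ∈ I, a * x ∈ I

theorem exists_maximal_algIdeal
    (hacc : ∀ f : ℕ → Submodule K A, (∀ k, IsAlgIdeal (f k)) → Monotone f →
      ∃ n, ∀ m, n ≤ m → f m = f n)
    (C : Set (Submodule K A)) (hC : C.Nonempty) (hI : ∀ I ∈ C, IsAlgIdeal I) :
    ∃ I, Maximal (· ∈ C) I := by
  have hwf : WellFoundedGT {I : Submodule K A // IsAlgIdeal I} := by
    refine wellFoundedGT_iff_monotone_chain_condition.2 fun f => ?_
    obtain ⟨n, hn⟩ := hacc (fun k => f k) (fun k => (f k).2) (fun i j hij => f.monotone hij)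
    exact ⟨n, fun m hm => Subtype.ext (hn m hm).symm⟩
  obtain ⟨I₀, hI₀⟩ := hC
  obtain ⟨I, hIC, hmax⟩ := hwf.wf.has_min {I | I.1 ∈ C} ⟨⟨I₀, hI _ hI₀⟩, hI₀⟩
  refine ⟨I, hIC, fun J hJ hIJ => ?_⟩
  by_contra hJI
  exact hmax ⟨J, hI J hJ⟩ hJ (lt_of_le_not_ge hIJ hJI)

/-- The ideal generated by `I` and `q`, as the set of elements that are reached from `I` and `q`
using only multiplications by `e` and by a finite subset of the ideal `N`. -/
def finiteReach (N I : Submodule K A) (e q : A) : Submodule K A where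
  carrier := {x | ∃ F : Finset A, (∀ f ∈ F, f ∈ N) ∧ ∀ Z : Submodule K A, I ≤ Z → q ∈ Z →
    (∀ z ∈ Z, e * z ∈ Z) → (∀ f ∈ F, ∀ z ∈ Z, f * z ∈ Z) → x ∈ Z}
  zero_mem' := ⟨∅, by simp, fun Z _ _ _ _ => zero_mem Z⟩
  add_mem' := by
    classical
    rintro x y ⟨F, hF, hx⟩ ⟨G, hG, hy⟩
    refine ⟨F ∪ G, fun f hf => (Finset.mem_union.1 hf).elim (hF f) (hG f),
      fun Z hI hq he hZ => add_mem (hx Z hI hq he fun f hf => ?_) (hy Z hI hq he fun f hf => ?_)⟩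
    · exact hZ f (Finset.mem_union_left _ hf)
    · exact hZ f (Finset.mem_union_right _ hf)
  smul_mem' := by
    rintro c x ⟨F, hF, hx⟩
    exact ⟨F, hF, fun Z hI hq he hZ => Submodule.smul_mem _ c (hx Z hI hq he hZ)⟩

theorem isAlgIdeal_finiteReach [IsScalarTower K A A] {ω : A →ₗ[K] K} {e : A}
    (hωe : ω e = 1) (I : Submodule K A) (q : A) : IsAlgIdeal (finiteReach (LinearMap.ker ω) I e q) := by
  classical
  rintro a x ⟨F, hF, hx⟩
  have han : a - ω a • e ∈ LinearMap.ker ω := by simp [hωe]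
  refine ⟨insert (a - ω a • e) F, fun f hf => ?_, fun Z hI hq he hZ => ?_⟩
  · rcases Finset.mem_insert.1 hf with rfl | hf
    · exact han
    · exact hF f hf
  · have hxZ := hx Z hI hq he fun f hf => hZ f (Finset.mem_insert_of_mem hf)
    have h1 := hZ _ (Finset.mem_insert_self _ _) x hxZ
    have h2 := Submodule.smul_mem Z (ω a) (he x hxZ)
    have h := add_mem h1 h2
    rwa [sub_mul, smul_mul_assoc, sub_add_cancel] at h

theorem le_finiteReach (N I : Submodule K A) (e q : A) : I ≤ finiteReach N I e q :=
  fun _ hx => ⟨∅, by simp, fun _ hI _ _ _ => hI hx⟩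

theorem mem_finiteReach (N I : Submodule K A) (e q : A) : q ∈ finiteReach N I e q :=
  ⟨∅, by simp, fun _ _ hq _ _ => hq⟩

end Ideals

section Bernstein

variable {K A : Type*} [Field K] [NonUnitalNonAssocCommRing A] [Module K A]
  [SMulCommClass K A A] [IsScalarTower K A A]

/-- The Peirce relations for an idempotent `e` of weight one in a Bernstein algebra. -/
theorem bernstein_peirce (h2 : (2 : K) ≠ 0) (h3 : (3 : K) ≠ 0)
    (ω : A →ₗ[K] K) (hbern : ∀ x : A, (x * x) * (x * x) = ω x ^ 2 • (x * x))
    {e : A} (he : e * e = e) (hωe : ω e = 1) {n : A} (hn : n ∈ LinearMap.ker ω) :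
    (2 : K) • (e * (e * n)) = e * n ∧
      (2 : K) • (e * (n * n)) = n * n - (4 : K) • ((e * n) * (e * n)) := by
  have hn0 : ω n = 0 := hn
  have hnn : (n * n) * (n * n) = 0 := by simpa [hn0] using hbern n
  have key (t : K) : t • ((4 : K) • (e * (e * n)) - (2 : K) • (e * n)) +
      t ^ 2 • ((4 : K) • ((e * n) * (e * n)) + (2 : K) • (e * (n * n)) - n * n) +
      t ^ 3 • ((4 : K) • ((e * n) * (n * n))) = 0 := by
    have h := hbern (e + t • n)
    simp only [map_add, map_smul, hn0, hωe, smul_zero, add_zero, one_pow, one_smul, mul_add,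
      add_mul, mul_smul_comm, smul_mul_assoc, he, hnn, mul_comm n e, mul_comm (e * n) e,
      mul_comm (n * n) e, mul_comm (n * n) (e * n)] at h
    rw [← sub_eq_zero] at h
    rw [← h]
    module
  have k1 := key 1
  have k2 := key (-1)
  have k3 := key 2
  generalize hX : (4 : K) • (e * (e * n)) - (2 : K) • (e * n) = X at k1 k2 k3
  generalize hY : (4 : K) • ((e * n) * (e * n)) + (2 : K) • (e * (n * n)) - n * n = Y
    at k1 k2 k3
  generalize (4 : K) • ((e * n) * (n * n)) = Z at k1 k2 k3
  have hY0 : (2 : K) • Y = 0 := by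
    linear_combination (norm := module) k1 + k2
  have hY1 : Y = 0 := (smul_eq_zero.1 hY0).resolve_left h2
  subst hY1
  have hX0 : ((2 : K) * 3) • X = 0 := by
    linear_combination (norm := module) (8 : K) • k1 - k3
  have hX1 : X = 0 := (smul_eq_zero.1 hX0).resolve_left (mul_ne_zero h2 h3)
  subst hX1
  constructor
  · refine smul_right_injective A h2 ?_
    linear_combination (norm := module) hX
  · linear_combination (norm := module) hY

theorem bernstein_idempotent_mul_mul (h2 : (2 : K) ≠ 0) (h3 : (3 : K) ≠ 0)
    (ω : A →ₗ[K] K) (hbern : ∀ x : A, (x * x) * (x * x) = ω x ^ 2 • (x * x))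
    {e : A} (he : e * e = e) (hωe : ω e = 1) {x y : A}
    (hx : x ∈ LinearMap.ker ω) (hy : y ∈ LinearMap.ker ω) :
    e * (x * y) = (2⁻¹ : K) • (x * y) - (2 : K) • ((e * x) * (e * y)) := by
  have a := (bernstein_peirce h2 h3 ω hbern he hωe hx).2
  have b := (bernstein_peirce h2 h3 ω hbern he hωe hy).2
  have c := (bernstein_peirce h2 h3 ω hbern he hωe (add_mem hx hy)).2
  simp only [mul_add, add_mul, mul_comm y x, mul_comm (e * y) (e * x)] at c
  have d : (2 * 2 : K) • (e * (x * y)) =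
      (2 * 2 : K) • ((2⁻¹ : K) • (x * y) - (2 : K) • ((e * x) * (e * y))) := by
    rw [smul_sub, smul_smul, mul_assoc, mul_inv_cancel₀ h2]
    linear_combination (norm := module) c - a - b
  exact smul_right_injective A (mul_ne_zero h2 h2) d

theorem algPow_mem_of_mem {ω : A →ₗ[K] K} {e : A}
    (hmul : ∀ x ∈ LinearMap.ker ω, ∀ y ∈ LinearMap.ker ω,
      e * (x * y) = (2⁻¹ : K) • (x * y) - (2 : K) • ((e * x) * (e * y)))
    {T : Submodule K A} (hT : ∀ x ∈ T, ∀ y ∈ T, x * y ∈ T) (hTN : T ≤ LinearMap.ker ω)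
    (heT : ∀ x ∈ T, e * x ∈ T) {n : ℕ} (hn : 1 ≤ n) {x : A} (hx : x ∈ algPow T n) :
    e * x ∈ algPow T n := by
  induction n using Nat.strong_induction_on generalizing x with
  | _ n ih =>
    match n, hn with
    | 1, _ => simpa only [algPow_one] using heT x (by simpa only [algPow_one] using hx)
    | n + 2, _ =>
      suffices h : algPow T (n + 2) ≤ (algPow T (n + 2)).comap (LinearMap.mul K A e) from h hx
      refine algPow_add_two_le fun r s hr hs hrs => subMul_le.2 fun a ha b hb => ?_
      have hle {k : ℕ} (hk : 1 ≤ k) : algPow T k ≤ LinearMap.ker ω :=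
        (algPow_antitone hT le_rfl hk).trans (by rwa [algPow_one])
      rw [Submodule.mem_comap, LinearMap.mul_apply', hmul a (hle hr ha) b (hle hs hb), ← hrs]
      exact sub_mem (Submodule.smul_mem _ _ (mul_mem_algPow hr hs ha hb))
        (Submodule.smul_mem _ _ (mul_mem_algPow hr hs
          (ih r (by omega) hr ha) (ih s (by omega) hs hb)))

theorem exists_nilpotent_invariant_subalgebra {ω : A →ₗ[K] K}
    (hωmul : ∀ x y : A, ω (x * y) = ω x * ω y) {e : A}
    (he2 : ∀ x ∈ LinearMap.ker ω, e * (e * x) = (2⁻¹ : K) • (e * x))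
    (hmul : ∀ x ∈ LinearMap.ker ω, ∀ y ∈ LinearMap.ker ω,
      e * (x * y) = (2⁻¹ : K) • (x * y) - (2 : K) • ((e * x) * (e * y)))
    (hln : ∀ s : Finset A, (↑s : Set A) ⊆ (LinearMap.ker ω : Set A) →
      ∃ n, 1 ≤ n ∧ algPow (NonUnitalAlgebra.adjoin K (↑s : Set A)).toSubmodule n = ⊥)
    (s : Finset A) (hs : ∀ x ∈ s, x ∈ LinearMap.ker ω) :
    ∃ T : Submodule K A, (∀ x ∈ s, x ∈ T) ∧ T ≤ LinearMap.ker ω ∧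
      (∀ x ∈ T, ∀ y ∈ T, x * y ∈ T) ∧ (∀ x ∈ T, e * x ∈ T) ∧ ∃ n, 1 ≤ n ∧ algPow T n = ⊥ := by
  classical
  set s' : Finset A := s ∪ s.image (e * ·) with hs'
  have hs'N : ∀ x ∈ s', x ∈ LinearMap.ker ω := by
    intro x hx
    rcases Finset.mem_union.1 hx with hx | hx
    · exact hs x hx
    · obtain ⟨y, hy, rfl⟩ := Finset.mem_image.1 hx
      have hy0 : ω y = 0 := hs y hy
      simp [hωmul, hy0]
  have hmem {x : A} (hx : x ∈ s') : x ∈ NonUnitalAlgebra.adjoin K (↑s' : Set A) :=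
    NonUnitalAlgebra.subset_adjoin K hx
  have hTN : ∀ x ∈ NonUnitalAlgebra.adjoin K (↑s' : Set A), x ∈ LinearMap.ker ω := by
    intro x hx
    induction hx using NonUnitalAlgebra.adjoin_induction with
    | mem x hx => exact hs'N x hx
    | add x y _ _ hx hy => exact add_mem hx hy
    | zero => exact zero_mem _
    | mul x y _ _ hx hy =>
      have hx0 : ω x = 0 := hx
      simp [hωmul, hx0]
    | smul r x _ hx => exact Submodule.smul_mem _ r hx
  refine ⟨(NonUnitalAlgebra.adjoin K (↑s' : Set A)).toSubmodule,
    fun x hx => hmem (Finset.mem_union_left _ hx), hTN,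
    fun x hx y hy => (NonUnitalAlgebra.adjoin K (↑s' : Set A)).mul_mem hx hy,
    fun x hx => ?_, hln s' hs'N⟩
  change e * x ∈ NonUnitalAlgebra.adjoin K (↑s' : Set A)
  replace hx : x ∈ NonUnitalAlgebra.adjoin K (↑s' : Set A) := hx
  induction hx using NonUnitalAlgebra.adjoin_induction with
  | mem x hx =>
    rcases Finset.mem_union.1 (Finset.mem_coe.1 hx) with hx | hx
    · exact hmem (Finset.mem_union_right _ (Finset.mem_image_of_mem _ hx))
    · obtain ⟨y, hy, rfl⟩ := Finset.mem_image.1 hx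
      rw [he2 y (hs y hy)]
      exact SMulMemClass.smul_mem _ (hmem (Finset.mem_union_right _ hx))
  | add x y _ _ hx hy => rw [mul_add]; exact add_mem hx hy
  | zero => rw [mul_zero]; exact zero_mem _
  | mul x y hx hy hex hey =>
    rw [hmul x (hTN x hx) y (hTN y hy)]
    exact sub_mem (SMulMemClass.smul_mem _ (mul_mem hx hy))
      (SMulMemClass.smul_mem _ (mul_mem hex hey))
  | smul r x _ hx => rw [mul_smul_comm]; exact SMulMemClass.smul_mem _ hx

/-- If `p` belongs to the ideal generated by `I` and a multiple `n * p` with `n` in a locally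
nilpotent ideal, then `p ∈ I`. -/
theorem mem_of_mem_finiteReach_mul {ω : A →ₗ[K] K} {e : A}
    (hmul : ∀ x ∈ LinearMap.ker ω, ∀ y ∈ LinearMap.ker ω,
      e * (x * y) = (2⁻¹ : K) • (x * y) - (2 : K) • ((e * x) * (e * y)))
    (hT : ∀ s : Finset A, (∀ x ∈ s, x ∈ LinearMap.ker ω) →
      ∃ T : Submodule K A, (∀ x ∈ s, x ∈ T) ∧ T ≤ LinearMap.ker ω ∧
      (∀ x ∈ T, ∀ y ∈ T, x * y ∈ T) ∧ (∀ x ∈ T, e * x ∈ T) ∧ ∃ n, 1 ≤ n ∧ algPow T n = ⊥)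
    {I : Submodule K A} (hI : IsAlgIdeal I) {n p : A} (hn : n ∈ LinearMap.ker ω)
    (hp : p ∈ LinearMap.ker ω) (h : p ∈ finiteReach (LinearMap.ker ω) I e (n * p)) :
    p ∈ I := by
  classical
  obtain ⟨F, hF, hpF⟩ := h
  obtain ⟨T, hsT, hTN, hTmul, heT, m, hm, hm0⟩ := hT (insert n (insert p F)) (by
    intro x hx
    simp only [Finset.mem_insert] at hx
    rcases hx with rfl | rfl | hx
    · exact hn
    · exact hp
    · exact hF x hx)
  have hnT : n ∈ T := hsT n (by simp)
  have hpT : p ∈ T := hsT p (by simp)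
  have key : ∀ k, 1 ≤ k → p ∈ algPow T k ⊔ I := by
    intro k hk
    induction k, hk using Nat.le_induction with
    | base => rw [algPow_one]; exact Submodule.mem_sup_left hpT
    | succ k hk ih =>
      have hmulT {f z : A} (hf : f ∈ T) {j : ℕ} (hj : 1 ≤ j) (hz : z ∈ algPow T j ⊔ I) :
          f * z ∈ algPow T (j + 1) ⊔ I := by
        obtain ⟨t, ht, i, hi, rfl⟩ := Submodule.mem_sup.1 hz
        rw [mul_add]
        refine Submodule.add_mem_sup ?_ (hI f i hi)
        rw [add_comm j]
        exact mul_mem_algPow le_rfl hj (by rwa [algPow_one]) ht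
      refine hpF _ le_sup_right (hmulT hnT hk ih) (fun z hz => ?_) (fun f hf z hz => ?_)
      · obtain ⟨t, ht, i, hi, rfl⟩ := Submodule.mem_sup.1 hz
        rw [mul_add]
        exact Submodule.add_mem_sup
          (algPow_mem_of_mem hmul hTmul hTN heT (by omega) ht) (hI e i hi)
      · exact sup_le_sup_right (algPow_succ_le hTmul (by omega)) I
          (hmulT (hsT f (by simp [hf])) (by omega) hz)
  simpa [hm0] using key m hm

/-- In a Noetherian algebra, an ideal `M` of the locally nilpotent ideal `N = ker ω` with
`M ⊆ N M` vanishes. -/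
theorem eq_bot_of_le_subMul {ω : A →ₗ[K] K} {e : A} (hωe : ω e = 1)
    (hmul : ∀ x ∈ LinearMap.ker ω, ∀ y ∈ LinearMap.ker ω,
      e * (x * y) = (2⁻¹ : K) • (x * y) - (2 : K) • ((e * x) * (e * y)))
    (hT : ∀ s : Finset A, (∀ x ∈ s, x ∈ LinearMap.ker ω) →
      ∃ T : Submodule K A, (∀ x ∈ s, x ∈ T) ∧ T ≤ LinearMap.ker ω ∧
      (∀ x ∈ T, ∀ y ∈ T, x * y ∈ T) ∧ (∀ x ∈ T, e * x ∈ T) ∧ ∃ n, 1 ≤ n ∧ algPow T n = ⊥)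
    (hacc : ∀ f : ℕ → Submodule K A, (∀ k, IsAlgIdeal (f k)) → Monotone f →
      ∃ n, ∀ m, n ≤ m → f m = f n)
    {M : Submodule K A} (hM : IsAlgIdeal M) (hMN : M ≤ LinearMap.ker ω)
    (hle : M ≤ subMul (LinearMap.ker ω) M) : M = ⊥ := by
  by_contra hM0
  obtain ⟨I, ⟨hI, hIM⟩, hmax⟩ := exists_maximal_algIdeal hacc {I | IsAlgIdeal I ∧ I < M}
    ⟨⊥, fun a x hx => by simp_all, bot_lt_iff_ne_bot.2 hM0⟩ fun I hI => hI.1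
  refine hIM.not_ge (hle.trans (subMul_le.2 fun n hn p hp => ?_))
  by_contra hnp
  have hJ := isAlgIdeal_finiteReach hωe I (n * p)
  have hMJ : M ≤ finiteReach (LinearMap.ker ω) I e (n * p) := by
    by_contra hMJ
    refine hnp (hmax (y := M ⊓ finiteReach (LinearMap.ker ω) I e (n * p)) ⟨?_, ?_⟩ ?_ ?_)
    · exact fun a x hx => ⟨hM a x hx.1, hJ a x hx.2⟩
    · exact inf_lt_left.2 hMJ
    · exact le_inf hIM.le (le_finiteReach _ _ _ _)
    · exact ⟨hM n p hp, mem_finiteReach _ _ _ _⟩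
  exact hnp (hI n p (mem_of_mem_finiteReach_mul hmul hT hI hn (hMN hp) (hMJ hp)))

/-- The ideal `N = ker ω` of a Noetherian algebra is finitely generated modulo its square. -/
theorem exists_finiteDimensional_sup_algPow_two {ω : A →ₗ[K] K} {e : A} (hωe : ω e = 1)
    (hN : IsAlgIdeal (LinearMap.ker ω))
    (he2 : ∀ x ∈ LinearMap.ker ω, e * (e * x) = (2⁻¹ : K) • (e * x))
    (heN2 : ∀ x ∈ algPow (LinearMap.ker ω) 2, e * x ∈ algPow (LinearMap.ker ω) 2)
    (hacc : ∀ f : ℕ → Submodule K A, (∀ k, IsAlgIdeal (f k)) → Monotone f →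
      ∃ n, ∀ m, n ≤ m → f m = f n) :
    ∃ s : Finset A, (∀ x ∈ s, x ∈ LinearMap.ker ω) ∧
      LinearMap.ker ω ≤ Submodule.span K (s : Set A) ⊔ algPow (LinearMap.ker ω) 2 := by
  classical
  have hN2 : algPow (LinearMap.ker ω) 2 ≤ LinearMap.ker ω := by
    simpa only [algPow_one] using
      algPow_succ_le (S := LinearMap.ker ω) (fun x _ y hy => hN x y hy) le_rfl
  have hideal (s : Finset A) (hs : ∀ x ∈ s, x ∈ LinearMap.ker ω) (hes : ∀ x ∈ s, e * x ∈
      Submodule.span K (s : Set A)) :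
      IsAlgIdeal (Submodule.span K (s : Set A) ⊔ algPow (LinearMap.ker ω) 2) := by
    intro a x hx
    have hspan : Submodule.span K (s : Set A) ≤ LinearMap.ker ω := Submodule.span_le.2 hs
    have hxN : x ∈ LinearMap.ker ω := sup_le hspan hN2 hx
    have han : a - ω a • e ∈ LinearMap.ker ω := by simp [hωe]
    have h1 : (a - ω a • e) * x ∈ algPow (LinearMap.ker ω) 2 :=
      mul_mem_algPow (r := 1) (s := 1) le_rfl le_rfl (by rwa [algPow_one]) (by rwa [algPow_one])
    have h2 : e * x ∈ Submodule.span K (s : Set A) ⊔ algPow (LinearMap.ker ω) 2 := by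
      obtain ⟨y, hy, z, hz, rfl⟩ := Submodule.mem_sup.1 hx
      rw [mul_add]
      refine Submodule.add_mem_sup ?_ (heN2 z hz)
      have hle : Submodule.span K (s : Set A) ≤
          (Submodule.span K (s : Set A)).comap (LinearMap.mul K A e) := Submodule.span_le.2 hes
      exact hle hy
    have h := add_mem (Submodule.mem_sup_right h1) (Submodule.smul_mem _ (ω a) h2)
    rwa [sub_mul, smul_mul_assoc, sub_add_cancel] at h
  obtain ⟨I, ⟨s, hs, hes, rfl⟩, hmax⟩ := exists_maximal_algIdeal hacc
    {I | ∃ s : Finset A, (∀ x ∈ s, x ∈ LinearMap.ker ω) ∧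
      (∀ x ∈ s, e * x ∈ Submodule.span K (s : Set A)) ∧
      I = Submodule.span K (s : Set A) ⊔ algPow (LinearMap.ker ω) 2}
    ⟨_, ∅, by simp, by simp, rfl⟩ (by rintro I ⟨s, hs, hes, rfl⟩; exact hideal s hs hes)
  refine ⟨s, hs, fun x hx => ?_⟩
  have hsub : (s : Set A) ⊆ (insert x (insert (e * x) s) : Finset A) := fun y hy => by
    simp [Finset.mem_coe.1 hy]
  have hexs : e * x ∈ Submodule.span K ((insert x (insert (e * x) s) : Finset A) : Set A) :=
    Submodule.subset_span (by simp)
  refine hmax ⟨insert x (insert (e * x) s), ?_, ?_, rfl⟩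
    (sup_le_sup_right (Submodule.span_mono hsub) _)
    (Submodule.mem_sup_left (Submodule.subset_span (by simp)))
  · simp only [Finset.mem_insert]
    rintro y (rfl | rfl | hy)
    · exact hx
    · exact hN e x hx
    · exact hs y hy
  · intro y hy
    simp only [Finset.mem_insert] at hy
    rcases hy with rfl | rfl | hy
    · exact hexs
    · rw [he2 x hx]
      exact Submodule.smul_mem _ _ hexs
    · exact Submodule.span_mono hsub (hes y hy)

end Bernstein

/-- Let `A` be a Bernstein algebra over a field `K` of characteristic `≠ 2, 3`
whose barideal `N = ker ω` is locally nilpotent.  If `A` is Noetherian (a.c.c. on ideals),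
then `A` is finite-dimensional over `K`. -/
theorem bernstein_locallyNilpotent_noetherian_finiteDimensional {K A : Type*} [Field K]
    [NonUnitalNonAssocCommRing A] [Module K A] [SMulCommClass K A A] [IsScalarTower K A A]
    (h2 : (2 : K) ≠ 0) (h3 : (3 : K) ≠ 0)
    (ω : A →ₗ[K] K) (hωmul : ∀ x y : A, ω (x * y) = ω x * ω y) (hω0 : ω ≠ 0)
    (hbern : ∀ x : A, (x * x) * (x * x) = ω x ^ 2 • (x * x))
    -- the barideal `N = ker ω` is locally nilpotent
    (hln : ∀ s : Finset A, (↑s : Set A) ⊆ (LinearMap.ker ω : Set A) →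
      ∃ n, 1 ≤ n ∧ algPow (NonUnitalAlgebra.adjoin K (↑s : Set A)).toSubmodule n = ⊥)
    -- `A` is Noetherian : a.c.c. on ideals of `A`
    (hacc : ∀ f : ℕ → Submodule K A, (∀ k, ∀ a : A, ∀ x ∈ f k, a * x ∈ f k) → Monotone f →
      ∃ n, ∀ m, n ≤ m → f m = f n) :
    FiniteDimensional K A := by
  obtain ⟨e, he, hωe⟩ : ∃ e : A, e * e = e ∧ ω e = 1 := by
    obtain ⟨x, hx⟩ := DFunLike.ne_iff.1 hω0
    have h1 : ω ((ω x)⁻¹ • x) = 1 := by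
      rw [map_smul, smul_eq_mul, inv_mul_cancel₀ hx]
    refine ⟨((ω x)⁻¹ • x) * ((ω x)⁻¹ • x), ?_, ?_⟩
    · rw [hbern, h1, one_pow, one_smul]
    · rw [hωmul, h1, one_mul]
  have hN : IsAlgIdeal (LinearMap.ker ω) := by
    intro a x hx
    have hx0 : ω x = 0 := hx
    simp [hωmul, hx0]
  have hNmul : ∀ x ∈ LinearMap.ker ω, ∀ y ∈ LinearMap.ker ω, x * y ∈ LinearMap.ker ω :=
    fun x _ y hy => hN x y hy
  have he2 : ∀ x ∈ LinearMap.ker ω, e * (e * x) = (2⁻¹ : K) • (e * x) := by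
    intro x hx
    rw [eq_inv_smul_iff₀ h2]
    exact (bernstein_peirce h2 h3 ω hbern he hωe hx).1
  have hmul : ∀ x ∈ LinearMap.ker ω, ∀ y ∈ LinearMap.ker ω,
      e * (x * y) = (2⁻¹ : K) • (x * y) - (2 : K) • ((e * x) * (e * y)) :=
    fun x hx y hy => bernstein_idempotent_mul_mul h2 h3 ω hbern he hωe hx hy
  have heN {k : ℕ} (hk : 1 ≤ k) {x : A} (hx : x ∈ algPow (LinearMap.ker ω) k) :
      e * x ∈ algPow (LinearMap.ker ω) k :=
    algPow_mem_of_mem hmul hNmul le_rfl (hN e) hk hx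
  obtain ⟨s, hs, hNs⟩ := exists_finiteDimensional_sup_algPow_two hωe hN he2
    (fun x hx => heN (by omega) hx) hacc
  have hspan : Submodule.span K (s : Set A) ≤ LinearMap.ker ω := Submodule.span_le.2 hs
  obtain ⟨n, hn, hn0⟩ := hln s hs
  have hpow {m : ℕ} (hm : n ≤ m) : algPow (Submodule.span K (s : Set A)) m = ⊥ := by
    refine le_bot_iff.1 (hn0 ▸ (algPow_mono ?_ (hn.trans hm)).trans
      (algPow_antitone (fun x hx y hy => (NonUnitalAlgebra.adjoin K (s : Set A)).mul_mem hx hy)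
        hn hm))
    exact Submodule.span_le.2 (NonUnitalAlgebra.subset_adjoin K)
  have hstable {m : ℕ} (hm : n ≤ m) :
      algPow (LinearMap.ker ω) n ≤ algPow (LinearMap.ker ω) m := by
    induction m, hm using Nat.le_induction with
    | base => exact le_rfl
    | succ m hm ih =>
      have h := algPow_le_algPow_sup hspan hNs (hn.trans hm)
      rw [hpow hm, bot_sup_eq] at h
      exact ih.trans h
  have hleN {k : ℕ} (hk : 1 ≤ k) : algPow (LinearMap.ker ω) k ≤ LinearMap.ker ω :=
    (algPow_antitone hNmul le_rfl hk).trans (by rw [algPow_one])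
  have hideal : IsAlgIdeal (algPow (LinearMap.ker ω) n) := by
    intro a x hx
    have han : a - ω a • e ∈ LinearMap.ker ω := by simp [hωe]
    have h1 : (a - ω a • e) * x ∈ algPow (LinearMap.ker ω) (1 + n) :=
      mul_mem_algPow le_rfl hn (by rwa [algPow_one]) hx
    have h := add_mem (algPow_antitone hNmul hn (by omega) h1)
      (Submodule.smul_mem _ (ω a) (heN hn hx))
    rwa [sub_mul, smul_mul_assoc, sub_add_cancel] at h
  have hself : algPow (LinearMap.ker ω) n ≤
      subMul (LinearMap.ker ω) (algPow (LinearMap.ker ω) n) := by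
    refine (hstable (m := 2 * n + 2) (by omega)).trans
      (algPow_add_two_le fun r t hr ht hrt => subMul_le.2 fun x hx y hy => ?_)
    obtain hrn | htn : n ≤ r ∨ n ≤ t := by omega
    · rw [mul_comm]
      exact mul_mem_subMul (hleN ht hy) (algPow_antitone hNmul hn hrn hx)
    · exact mul_mem_subMul (hleN hr hx) (algPow_antitone hNmul hn htn hy)
  have hbot := eq_bot_of_le_subMul hωe hmul
    (exists_nilpotent_invariant_subalgebra hωmul he2 hmul hln) hacc hideal (hleN hn) hself
  have hfin : FiniteDimensional K (Submodule.span K (s : Set A)) :=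
    FiniteDimensional.span_finset K s
  have hfinN := finiteDimensional_of_le_sup_algPow hspan hNs hn hbot
  have htop : LinearMap.ker ω ⊔ Submodule.span K {e} = ⊤ := by
    refine eq_top_iff.2 fun a _ => Submodule.mem_sup.2
      ⟨a - ω a • e, by simp [hωe], ω a • e, Submodule.mem_span_singleton.2 ⟨_, rfl⟩, by simp⟩
  have hfinA : FiniteDimensional K (⊤ : Submodule K A) := by
    rw [← htop]
    infer_instance
  exact Module.finite_def.2 (Module.Finite.iff_fg.1 hfinA)
end
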